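/- arXiv:2411.00421 — 2 statements merged into one kernel-verified Lean document; each statement's English description precedes it below -/
import Mathlib

section
/- Let p be a prime, n ≥ 1, k ≥ 1, and set m = k(p−1). Let N = T_0 ∈ R_n; the ideal of R_n generated by N equals ℤ·N (since x·N = N), and each ψ_m^{(ℓ)} preserves ℤ·N (since σ_ℓ(N) = N and N·u_m^{(ℓ)} = ℓ^m·N), hence induces an additive endomorphism ψ̄_m^{(ℓ)} of the quotient group R̄_n = R_n/ℤ·N. For 1 ≤ s ≤ n let b_s be the least multiple of p^{s−1}(p−1) with b_s ≥ m, and set E_s = ∏_{t=m+1}^{b_s} (1 − x^{d_t}) ∈ R_n. Then the additive group {f̄ ∈ R̄_n : ψ̄_m^{(ℓ)}(f̄) = f̄ for every integer ℓ ≥ 1 coprime to p} is free with ℤ-basis the classes of E_s·T_s for 1 ≤ s ≤ n. (This is the computation M^ℂ_{2k(p−1)−1} = ℤ{a^{b_s−k(p−1)}·a^{1/2}·t_{n,s}·β_{b_s} : 1 ≤ s ≤ n} of the Adams-fixed subgroup of π_{0,2k(p−1)−1}KU_{C_{p^n}}, using the identification of π_{0,2k(p−1)−1}KU_{C_{p^n}}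 with the cokernel of the transfer, i.e. with R_n/ℤ·N.) -/
open Polynomial

noncomputable section

/-- The ring `R_n = ℤ[X]/(X^{p^n} - 1)`, the complex representation ring `RU(C_{p^n})`. -/
abbrev Rring (p n : ℕ) : Type :=
  Polynomial ℤ ⧸ Ideal.span {(X : Polynomial ℤ) ^ p ^ n - 1}

/-- The residue class `x` of `X` in `R_n`. -/
def xcl (p n : ℕ) : Rring p n := Ideal.Quotient.mk _ X

theorem xcl_pow (p n : ℕ) : xcl p n ^ p ^ n = 1 := by
  unfold xcl
  have hmem : ((X : Polynomial ℤ) ^ p ^ n - 1) ∈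
      Ideal.span {(X : Polynomial ℤ) ^ p ^ n - 1} :=
    Ideal.subset_span (Set.mem_singleton _)
  have h0 := Ideal.Quotient.eq_zero_iff_mem.mpr hmem
  rw [map_sub, map_pow, map_one] at h0
  exact sub_eq_zero.mp h0

/-- `x` as a unit of `R_n` (its inverse is `x^{p^n - 1}`). -/
def xunit (p n : ℕ) (hp : 0 < p) : (Rring p n)ˣ :=
  Units.mkOfMulEqOne (xcl p n) (xcl p n ^ (p ^ n - 1)) (by
    have h1 : p ^ n - 1 + 1 = p ^ n := by
      have := pow_pos hp n; omega
    calc xcl p n * xcl p n ^ (p ^ n - 1) = xcl p n ^ (p ^ n - 1 + 1) := by ring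
      _ = 1 := by rw [h1, xcl_pow])

/-- `x^d` for an arbitrary integer `d` (using that `x` is a unit of `R_n`). -/
def xz (p n : ℕ) (hp : 0 < p) (d : ℤ) : Rring p n :=
  ((xunit p n hp ^ d : (Rring p n)ˣ) : Rring p n)

/-- `T_i = Σ_{t=0}^{p^{n-i}-1} x^{t·p^i}`, the class of the transitive
`C_{p^n}`-set `C_{p^n}/C_{p^i}` under the marks isomorphism. -/
def Tel (p n i : ℕ) : Rring p n :=
  ∑ t ∈ Finset.range (p ^ (n - i)), xcl p n ^ (t * p ^ i)

/-- `Z_0 = p·T_0` and `Z_i = p·T_i - T_{i-1}` for `i ≥ 1`. -/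
def Zel (p n i : ℕ) : Rring p n :=
  if i = 0 then (p : Rring p n) * Tel p n 0
  else (p : Rring p n) * Tel p n i - Tel p n (i - 1)

end

/-- `acopr p t` is the `t`-th (1-indexed) positive integer coprime to `p`,
i.e. the increasing enumeration `a_1 < a_2 < ⋯` of positive integers coprime to `p`. -/
noncomputable def acopr (p t : ℕ) : ℕ :=
  Nat.nth (fun k => 0 < k ∧ Nat.Coprime k p) (t - 1)

/-- The sequence `d_1, d_2, …` given by `d_{2t-1} = a_t` and `d_{2t} = -a_t`. -/
noncomputable def dseq (p j : ℕ) : ℤ :=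
  if j % 2 = 1 then (acopr p ((j + 1) / 2) : ℤ) else -(acopr p (j / 2) : ℤ)

open Polynomial in
/-- The ring homomorphism `σ_ℓ : R_n → R_n` determined by `x ↦ x^ℓ` (well defined
since `(x^ℓ)^{p^n} = 1`). -/
noncomputable def sigmaHom (p n ℓ : ℕ) : Rring p n →+* Rring p n :=
  Ideal.Quotient.lift _ (aeval (R := ℤ) (xcl p n ^ ℓ)).toRingHom (by
    intro f hf
    obtain ⟨g, rfl⟩ := Ideal.mem_span_singleton.mp hf
    have h : (aeval (R := ℤ) (xcl p n ^ ℓ)) ((X : Polynomial ℤ) ^ p ^ n - 1) = 0 := by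
      rw [map_sub, map_pow, aeval_X, map_one, ← pow_mul, mul_comm ℓ (p ^ n), pow_mul,
        xcl_pow, one_pow, sub_self]
    simp only [AlgHom.toRingHom_eq_coe, RingHom.coe_coe, map_mul, h, zero_mul])

/-- `u_m^{(ℓ)} = ∏_{j=1}^m (Σ_{i=0}^{ℓ-1} x^{i·d_j}) ∈ R_n`; the Adams operation `ψ^ℓ`
on `π_{0,2m}KU_{C_{p^n}} ≅ R_n·β_m` is `f ↦ σ_ℓ(f)·u_m^{(ℓ)}`. -/
noncomputable def useq (p n : ℕ) (hp : 0 < p) (ℓ m : ℕ) : Rring p n :=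
  ∏ j ∈ Finset.Icc 1 m, ∑ i ∈ Finset.range ℓ, xz p n hp ((i : ℤ) * dseq p j)

/-- `bfun p k s` is the least multiple of `p^{s-1}(p-1)` that is `≥ m = k(p-1)`. -/
noncomputable def bfun (p k s : ℕ) : ℕ :=
  (p ^ (s - 1) * (p - 1)) *
    ((k * (p - 1) + p ^ (s - 1) * (p - 1) - 1) / (p ^ (s - 1) * (p - 1)))

/-- `E_s = ∏_{t=m+1}^{b_s} (1 - x^{d_t}) ∈ R_n`, where `m = k(p-1)` and `b_s = bfun p k s`. -/
noncomputable def Efun (p n : ℕ) (hp : 0 < p) (k s : ℕ) : Rring p n :=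
  ∏ t ∈ Finset.Icc (k * (p - 1) + 1) (bfun p k s), (1 - xz p n hp (dseq p t))

/-- Evaluation of `R_n` at a `p^n`-th root of unity. -/
noncomputable def evalRoot (p n : ℕ) (μ : ℂ) (hμ : μ ^ p ^ n = 1) : Rring p n →+* ℂ :=
  Ideal.Quotient.lift _ (aeval (R := ℤ) μ).toRingHom (by
    intro f hf
    obtain ⟨g, rfl⟩ := Ideal.mem_span_singleton.mp hf
    simp [hμ])

theorem evalRoot_mk (p n : ℕ) (μ : ℂ) (hμ : μ ^ p ^ n = 1) (F : ℤ[X]) :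
    evalRoot p n μ hμ (Ideal.Quotient.mk _ F) = aeval μ F := rfl

theorem evalRoot_xcl (p n : ℕ) (μ : ℂ) (hμ : μ ^ p ^ n = 1) :
    evalRoot p n μ hμ (xcl p n) = μ := by
  rw [xcl, evalRoot_mk, aeval_X]

theorem evalRoot_xz (p n : ℕ) (hp : 0 < p) (μ : ℂ) (hμ : μ ^ p ^ n = 1) (d : ℤ) :
    evalRoot p n μ hμ (xz p n hp d) = μ ^ d := by
  have h := map_zpow (Units.map (evalRoot p n μ hμ : Rring p n →* ℂ)) (xunit p n hp) d
  have h' := congrArg Units.val h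
  rw [Units.val_zpow_eq_zpow_val] at h'
  have hx : evalRoot p n μ hμ (xunit p n hp : Rring p n) = μ := evalRoot_xcl p n μ hμ
  exact h'.trans (congrArg (· ^ d) hx)

theorem sigmaHom_mk (p n ℓ : ℕ) (F : ℤ[X]) :
    sigmaHom p n ℓ (Ideal.Quotient.mk _ F) = aeval (xcl p n ^ ℓ) F := rfl

theorem evalRoot_sigmaHom (p n ℓ : ℕ) (μ : ℂ) (hμ : μ ^ p ^ n = 1)
    (hμ' : (μ ^ ℓ) ^ p ^ n = 1) (f : Rring p n) :
    evalRoot p n μ hμ (sigmaHom p n ℓ f) = evalRoot p n (μ ^ ℓ) hμ' f := by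
  obtain ⟨F, rfl⟩ := Ideal.Quotient.mk_surjective f
  rw [sigmaHom_mk, evalRoot_mk, aeval_def, aeval_def, hom_eval₂, map_pow, evalRoot_xcl]
  congr 1
  exact RingHom.ext_int _ _

theorem evalRoot_Tel_of_pow_eq_one (p n i : ℕ) (μ : ℂ) (hμ : μ ^ p ^ n = 1)
    (h : μ ^ p ^ i = 1) : evalRoot p n μ hμ (Tel p n i) = (p : ℂ) ^ (n - i) := by
  simp only [Tel, map_sum, map_pow, evalRoot_xcl]
  rw [Finset.sum_congr rfl (g := fun _ => (1 : ℂ))]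
  · simp
  · intro t _
    rw [mul_comm, pow_mul, h, one_pow]

theorem evalRoot_Tel_of_pow_ne_one (p n i : ℕ) (hi : i ≤ n) (μ : ℂ) (hμ : μ ^ p ^ n = 1)
    (h : μ ^ p ^ i ≠ 1) : evalRoot p n μ hμ (Tel p n i) = 0 := by
  simp only [Tel, map_sum, map_pow, evalRoot_xcl]
  have h1 : (∑ t ∈ Finset.range (p ^ (n - i)), (μ ^ p ^ i) ^ t) * (μ ^ p ^ i - 1) = 0 := by
    rw [geom_sum_mul, ← pow_mul, ← pow_add, Nat.add_sub_cancel' hi, hμ, sub_self]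
  have h2 := (mul_eq_zero.mp h1).resolve_right (sub_ne_zero.mpr h)
  rw [← h2]
  refine Finset.sum_congr rfl fun t _ => ?_
  rw [← pow_mul, mul_comm]

theorem sum_range_pow_mul {R : Type*} [CommRing R] (y : R) (a b : ℕ) :
    (∑ t ∈ Finset.range a, y ^ (t * b)) * ∑ i ∈ Finset.range b, y ^ i =
      ∑ t ∈ Finset.range (a * b), y ^ t := by
  induction a with
  | zero => simp
  | succ a ih =>
    rw [Finset.sum_range_succ, add_mul, ih, Nat.succ_mul, Finset.sum_range_add, Finset.mul_sum]
    simp only [pow_add]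

theorem Tel_succ_mul_cyclotomic (p n s : ℕ) (hp : p.Prime) (hs : s + 1 ≤ n) :
    Tel p n (s + 1) * Ideal.Quotient.mk _ (cyclotomic (p ^ (s + 1)) ℤ) = Tel p n s := by
  have := Fact.mk hp
  rw [cyclotomic_prime_pow_eq_geom_sum hp]
  have h := sum_range_pow_mul (xcl p n ^ p ^ s) (p ^ (n - (s + 1))) p
  have h1 : p ^ (n - (s + 1)) * p = p ^ (n - s) := by
    rw [← pow_succ]; congr 1; omega
  rw [h1] at h
  simp only [Tel]
  rw [map_sum]
  simp only [map_pow]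
  change _ * ∑ i ∈ Finset.range p, (xcl p n ^ p ^ s) ^ i = _
  simp only [← pow_mul] at h ⊢
  convert h using 3 <;> ring_nf

theorem Tel_zero_mul_mem (p n : ℕ) (f : Rring p n) :
    Tel p n 0 * f ∈ Submodule.span ℤ {Tel p n 0} := by
  have hx : Tel p n 0 * xcl p n = Tel p n 0 := by
    have h := mul_neg_geom_sum (xcl p n) (p ^ n)
    rw [xcl_pow, sub_self] at h
    have : Tel p n 0 = ∑ i ∈ Finset.range (p ^ n), xcl p n ^ i := by simp [Tel]
    rw [this]
    linear_combination -h
  have hxk : ∀ k : ℕ, Tel p n 0 * xcl p n ^ k = Tel p n 0 := by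
    intro k
    induction k with
    | zero => simp
    | succ k ih => rw [pow_succ, ← mul_assoc, ih, hx]
  obtain ⟨F, rfl⟩ := Ideal.Quotient.mk_surjective f
  induction F using Polynomial.induction_on' with
  | add F G hF hG => rw [map_add, mul_add]; exact add_mem hF hG
  | monomial k a =>
    rw [← Polynomial.C_mul_X_pow_eq_monomial, map_mul, map_pow]
    change Tel p n 0 * (_ * xcl p n ^ k) ∈ _
    rw [mul_left_comm, hxk]
    have : (Ideal.Quotient.mk _ (Polynomial.C a) : Rring p n) * Tel p n 0 = a • Tel p n 0 := by
      rw [zsmul_eq_mul]; simp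
    rw [this]
    exact Submodule.smul_mem _ _ (Submodule.mem_span_singleton_self _)

theorem exists_eq_Tel_mul (p n s : ℕ) (hp : p.Prime) (hs : s + 1 ≤ n) (μ : ℂ)
    (hμ : μ ^ p ^ n = 1) (hprim : IsPrimitiveRoot μ (p ^ (s + 1))) (g : Rring p n)
    (hg : evalRoot p n μ hμ g = 0) : ∃ g', Tel p n (s + 1) * g = Tel p n s * g' := by
  obtain ⟨G, rfl⟩ := Ideal.Quotient.mk_surjective g
  rw [evalRoot_mk] at hg
  have hpos : 0 < p ^ (s + 1) := pow_pos hp.pos _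
  have hd : cyclotomic (p ^ (s + 1)) ℤ ∣ G := by
    rw [cyclotomic_eq_minpoly hprim hpos]
    exact minpoly.isIntegrallyClosed_dvd (hprim.isIntegral hpos) hg
  obtain ⟨H, rfl⟩ := hd
  exact ⟨Ideal.Quotient.mk _ H, by rw [map_mul, ← mul_assoc, Tel_succ_mul_cyclotomic p n s hp hs]⟩

theorem exists_int_of_const_on_primitiveRoots (N : ℕ) (hN : 0 < N) (h : ℤ[X]) (c : ℂ)
    (H : ∀ μ ∈ primitiveRoots N ℂ, aeval μ h = c) : ∃ z : ℤ, c = z := by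
  have hmon := cyclotomic.monic N ℤ
  set r := h %ₘ cyclotomic N ℤ with hr
  have hcard : (primitiveRoots N ℂ).card = N.totient := Complex.card_primitiveRoots N
  have hz : r.map (Int.castRingHom ℂ) - C c = 0 := by
    refine eq_zero_of_degree_lt_of_eval_finset_eq_zero (primitiveRoots N ℂ) ?_ ?_
    · rw [hcard]
      refine lt_of_le_of_lt (degree_sub_le _ _) (max_lt ?_ ?_)
      · refine lt_of_le_of_lt degree_map_le ?_
        have := degree_modByMonic_lt h hmon
        rwa [degree_cyclotomic] at this
      · refine lt_of_le_of_lt degree_C_le ?_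
        exact_mod_cast Nat.totient_pos.mpr hN
    · intro μ hμ
      have hroot : aeval μ (cyclotomic N ℤ) = 0 := by
        have := ((mem_primitiveRoots hN).mp hμ).isRoot_cyclotomic hN
        rw [← map_cyclotomic N (Int.castRingHom ℂ), IsRoot.def, eval_map] at this
        exact this
      have h1 : aeval μ r = c := by
        rw [hr, modByMonic_eq_sub_mul_div, map_sub, map_mul, hroot, zero_mul, sub_zero,
          H μ hμ]
      rw [eval_sub, eval_C, eval_map]
      exact sub_eq_zero.mpr h1
  refine ⟨r.coeff 0, ?_⟩
  have := congrArg (fun q => coeff q 0) hz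
  simp only [coeff_sub, coeff_map, coeff_C_zero, coeff_zero] at this
  exact (sub_eq_zero.mp this).symm

theorem int_dvd_of_eq_mul_isIntegral (a b : ℤ) (z : ℂ) (hz : IsIntegral ℤ z)
    (h : (a : ℂ) = b * z) : b ∣ a := by
  rcases eq_or_ne b 0 with rfl | hb
  · simp at h; simp [h]
  have hb' : (b : ℂ) ≠ 0 := by exact_mod_cast hb
  have hq : z = algebraMap ℚ ℂ ((a : ℚ) / b) := by
    rw [map_div₀]; simp [h]; field_simp
  rw [hq, isIntegral_algebraMap_iff (algebraMap ℚ ℂ).injective] at hz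
  obtain ⟨w, hw⟩ := IsIntegrallyClosed.isIntegral_iff.mp hz
  refine ⟨w, ?_⟩
  have hb'' : (b : ℚ) ≠ 0 := by exact_mod_cast hb
  rw [eq_div_iff hb''] at hw
  have : (w * b : ℤ) = a := by
    have : ((w * b : ℤ) : ℚ) = a := by push_cast; exact hw
    exact_mod_cast this
  rw [← this, mul_comm]
theorem prod_range_count_nth {M : Type*} [CommMonoid M] (P : ℕ → Prop) [DecidablePred P]
    (f : ℕ → M) (b : ℕ) :
    ∏ i ∈ Finset.range (Nat.count P b), f (Nat.nth P i) = ∏ a ∈ Finset.range b with P a, f a := by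
  induction b with
  | zero => simp
  | succ b ih =>
    rw [Nat.count_succ, Finset.range_add_one, Finset.filter_insert]
    split_ifs with h
    · rw [Finset.prod_range_succ, ih, Nat.nth_count h, Finset.prod_insert (by simp), mul_comm]
    · rw [add_zero, ih]

theorem infinite_setOf_pos_coprime (p : ℕ) (hp : 0 < p) :
    {k : ℕ | 0 < k ∧ Nat.Coprime k p}.Infinite := by
  refine Set.infinite_of_injective_forall_mem (f := fun i : ℕ => p * i + 1) ?_ ?_
  · intro i j h
    simpa [hp.ne'] using h
  · intro i
    exact ⟨Nat.succ_pos _, by simp⟩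

theorem acopr_coprime (p t : ℕ) (hp : 0 < p) : Nat.Coprime (acopr p t) p :=
  (Nat.nth_mem_of_infinite (infinite_setOf_pos_coprime p hp) (t - 1)).2

theorem dseq_isCoprime (p t : ℕ) (hp : 0 < p) : IsCoprime (dseq p t) (p : ℤ) := by
  unfold dseq
  split_ifs
  · exact Nat.isCoprime_iff_coprime.mpr (acopr_coprime p _ hp)
  · exact (Nat.isCoprime_iff_coprime.mpr (acopr_coprime p _ hp)).neg_left

theorem prod_Icc_dseq {M : Type*} [CommMonoid M] (p : ℕ) (g : ℤ → M) (c : ℕ) :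
    ∏ t ∈ Finset.Icc 1 (2 * c), g (dseq p t) = ∏ i ∈ Finset.range c,
      (g (Nat.nth (fun k => 0 < k ∧ Nat.Coprime k p) i) *
        g (-(Nat.nth (fun k => 0 < k ∧ Nat.Coprime k p) i : ℤ))) := by
  induction c with
  | zero => simp
  | succ c ih =>
    rw [show 2 * (c + 1) = 2 * c + 1 + 1 by ring, Finset.prod_Icc_succ_top (by omega),
      Finset.prod_Icc_succ_top (by omega), ih, Finset.prod_range_succ, mul_assoc]
    have h1 : dseq p (2 * c + 1) = Nat.nth (fun k => 0 < k ∧ Nat.Coprime k p) c := by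
      rw [dseq, if_pos (by omega), acopr, show (2 * c + 1 + 1) / 2 - 1 = c by omega]
    have h2 : dseq p (2 * c + 1 + 1) =
        -(Nat.nth (fun k => 0 < k ∧ Nat.Coprime k p) c : ℤ) := by
      rw [dseq, if_neg (by omega), acopr, show (2 * c + 1 + 1) / 2 - 1 = c by omega]
    rw [h1, h2]

theorem prod_coprime_mul_reflect {M : Type*} [CommMonoid M] (p L b : ℕ) (f : ℕ → M)
    (hpL : p ∣ L) (hb : b = (L + 1) / 2) (hbL : 2 * b = L → ¬ Nat.Coprime b p) :
    ∏ a ∈ Finset.range b with (0 < a ∧ Nat.Coprime a p), (f a * f (L - a)) =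
      ∏ a ∈ Finset.range L with (0 < a ∧ Nat.Coprime a p), f a := by
  have hcop : ∀ a ≤ L, (Nat.Coprime (L - a) p ↔ Nat.Coprime a p) := by
    intro a ha
    obtain ⟨c, rfl⟩ := hpL
    have h : IsCoprime ((p * c - a : ℕ) : ℤ) (p : ℤ) ↔ IsCoprime (a : ℤ) (p : ℤ) := by
      rw [Nat.cast_sub ha, Nat.cast_mul, sub_eq_add_neg, add_comm,
        IsCoprime.add_mul_left_left_iff, IsCoprime.neg_left_iff]
    simpa [Nat.isCoprime_iff_coprime] using h
  have hbl : b ≤ L ∨ L = 0 := by omega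
  rcases hbl with hbl | rfl
  swap
  · simp [hb]
  rw [Finset.prod_mul_distrib]
  have hsplit : (Finset.range L).filter (fun a => 0 < a ∧ Nat.Coprime a p) =
      (Finset.range b).filter (fun a => 0 < a ∧ Nat.Coprime a p) ∪
      (Finset.Ico b L).filter (fun a => 0 < a ∧ Nat.Coprime a p) := by
    rw [← Finset.filter_union, Finset.range_eq_Ico, Finset.range_eq_Ico,
      Finset.Ico_union_Ico_eq_Ico (Nat.zero_le _) hbl]
  rw [hsplit, Finset.prod_union]
  · congr 1
    refine Finset.prod_nbij' (fun a => L - a) (fun a => L - a) ?_ ?_ ?_ ?_ ?_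
    · intro a ha
      simp only [Finset.mem_filter, Finset.mem_range, Finset.mem_Ico] at ha ⊢
      have := (hcop a (by omega)).mpr ha.2.2
      exact ⟨by omega, by omega, this⟩
    · intro a ha
      simp only [Finset.mem_filter, Finset.mem_range, Finset.mem_Ico] at ha ⊢
      have h1 := (hcop a (by omega)).mpr ha.2.2
      refine ⟨?_, by omega, h1⟩
      by_contra hlt
      have hab : a = b := by omega
      exact hbL (by omega) (hab ▸ ha.2.2)
    · intro a ha
      simp only [Finset.mem_filter, Finset.mem_range] at ha
      omega
    · intro a ha
      simp only [Finset.mem_filter, Finset.mem_Ico] at ha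
      omega
    · intro a _
      rfl
  · exact Finset.disjoint_filter_filter (by
      rw [Finset.range_eq_Ico]; exact Finset.Ico_disjoint_Ico_consecutive 0 b L)

theorem prod_coprime_periodic {M : Type*} [CommMonoid M] (p K q : ℕ) (f : ℕ → M) (hpK : p ∣ K)
    (h0 : ¬ Nat.Coprime 0 p) (hf : ∀ a, f (a + K) = f a) :
    ∏ a ∈ Finset.range (q * K) with (0 < a ∧ Nat.Coprime a p), f a =
      (∏ a ∈ Finset.range K with (0 < a ∧ Nat.Coprime a p), f a) ^ q := by
  have hpred : ∀ a : ℕ, (0 < a ∧ Nat.Coprime a p) ↔ Nat.Coprime a p := fun a =>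
    ⟨And.right, fun h => ⟨Nat.pos_of_ne_zero fun ha => h0 (ha ▸ h), h⟩⟩
  simp only [hpred]
  have hf' : ∀ q a, f (q * K + a) = f a := by
    intro q a
    induction q with
    | zero => simp
    | succ q ih => rw [← ih, ← hf (q * K + a)]; congr 1; ring
  simp only [Finset.prod_filter]
  induction q with
  | zero => simp
  | succ q ih =>
    rw [Nat.succ_mul, Finset.prod_range_add, ih, pow_succ]
    congr 1
    refine Finset.prod_congr rfl fun a _ => ?_
    obtain ⟨c, rfl⟩ := hpK
    rw [hf' q a, show q * (p * c) + a = a + p * (q * c) by ring]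
    simp only [Nat.coprime_add_mul_left_left]

theorem count_coprime_mul_pow (p q s : ℕ) (hp : p.Prime) (hs : 1 ≤ s) :
    Nat.count (fun k => 0 < k ∧ Nat.Coprime k p) (q * p ^ s) = q * (p ^ (s - 1) * (p - 1)) := by
  have h0 : ¬ Nat.Coprime 0 p := by simpa using hp.one_lt.ne'
  have h := prod_coprime_periodic p (p ^ s) q (fun _ => 2) (dvd_pow_self p (by omega)) h0
    (fun _ => rfl)
  rw [Finset.prod_const, Finset.prod_const, ← Nat.count_eq_card_filter_range, ← pow_mul] at h
  rw [Nat.pow_right_injective le_rfl h, mul_comm]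
  congr 1
  rw [← Nat.totient_prime_pow hp (by omega), Nat.totient]
  congr 1
  ext a
  simp only [Finset.mem_filter, Finset.mem_range, Nat.coprime_pow_left_iff (show 0 < s by omega)]
  refine and_congr_right fun _ => ?_
  rw [Nat.coprime_comm (n := p)]
  exact ⟨And.right, fun h => ⟨Nat.pos_of_ne_zero fun ha => h0 (ha ▸ h), h⟩⟩

theorem prod_one_sub_primitiveRoots (p j : ℕ) (hp : p.Prime) (hj : 1 ≤ j) :
    ∏ ν ∈ primitiveRoots (p ^ j) ℂ, (1 - ν) = p := by
  obtain ⟨i, rfl⟩ : ∃ i, j = i + 1 := ⟨j - 1, by omega⟩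
  have := Fact.mk hp
  have hprim := Complex.isPrimitiveRoot_exp (p ^ (i + 1)) (pow_pos hp.pos _).ne'
  rw [← eval_one_cyclotomic_prime_pow (R := ℂ) (p := p) i,
    cyclotomic_eq_prod_X_sub_primitiveRoots hprim, eval_prod]
  simp

theorem prod_one_sub_zpow_primitiveRoots (p j : ℕ) (hp : p.Prime) (hj : 1 ≤ j) (d : ℤ)
    (hd : IsCoprime d (p : ℤ)) :
    ∏ ν ∈ primitiveRoots (p ^ j) ℂ, (1 - ν ^ d) = p := by
  have hpos : 0 < p ^ j := pow_pos hp.pos _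
  rw [← prod_one_sub_primitiveRoots p j hp hj]
  have hd' : IsCoprime d ((p ^ j : ℕ) : ℤ) := by
    rw [Nat.cast_pow]; exact hd.pow_right
  obtain ⟨a, b, hab⟩ := hd'
  have hinv : ∀ ν ∈ primitiveRoots (p ^ j) ℂ, ν ^ (a * d) = ν := by
    intro ν hν
    have hν := (mem_primitiveRoots hpos).mp hν
    have hne : ν ≠ 0 := hν.ne_zero hpos.ne'
    have : a * d = 1 - (p ^ j : ℕ) * b := by linarith
    rw [this, zpow_sub₀ hne, zpow_mul, zpow_natCast, hν.pow_eq_one]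
    simp
  refine Finset.prod_nbij' (fun ν => ν ^ d) (fun ν => ν ^ a) ?_ ?_ ?_ ?_ ?_
  · intro ν hν
    rw [mem_primitiveRoots hpos] at hν ⊢
    exact hν.zpow_of_gcd_eq_one d (Int.isCoprime_iff_gcd_eq_one.mp ⟨a, b, hab⟩)
  · intro ν hν
    rw [mem_primitiveRoots hpos] at hν ⊢
    exact hν.zpow_of_gcd_eq_one a (Int.isCoprime_iff_gcd_eq_one.mp ⟨d, b, by linarith⟩)
  · intro ν hν
    rw [← zpow_mul, mul_comm, hinv ν hν]
  · intro ν hν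
    rw [← zpow_mul, hinv ν hν]
  · intro ν _
    rfl

theorem prod_coprime_one_sub_pow (p j : ℕ) (hp : p.Prime) (hj : 1 ≤ j) (μ : ℂ)
    (hμ : IsPrimitiveRoot μ (p ^ j)) :
    ∏ a ∈ Finset.range (p ^ j) with (0 < a ∧ Nat.Coprime a p), (1 - μ ^ a) = p := by
  have hpos : 0 < p ^ j := pow_pos hp.pos _
  have hpj : ∀ a : ℕ, a.Coprime (p ^ j) ↔ a.Coprime p := fun a =>
    Nat.coprime_pow_right_iff (by omega) a p
  rw [← prod_one_sub_primitiveRoots p j hp hj]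
  refine Finset.prod_bij (fun a _ => μ ^ a) ?_ ?_ ?_ ?_
  · intro a ha
    simp only [Finset.mem_filter, Finset.mem_range] at ha
    exact (mem_primitiveRoots hpos).mpr (hμ.pow_of_coprime a ((hpj a).mpr ha.2.2))
  · intro a ha b hb hab
    simp only [Finset.mem_filter, Finset.mem_range] at ha hb
    exact hμ.pow_inj ha.1 hb.1 hab
  · intro ν hν
    have : NeZero (p ^ j) := ⟨hpos.ne'⟩
    obtain ⟨i, hi, hic, rfl⟩ := hμ.isPrimitiveRoot_iff.mp ((mem_primitiveRoots hpos).mp hν)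
    refine ⟨i, ?_, rfl⟩
    simp only [Finset.mem_filter, Finset.mem_range]
    have hc := (hpj i).mp hic
    refine ⟨hi, Nat.pos_of_ne_zero ?_, hc⟩
    rintro rfl
    exact hp.one_lt.ne' (by simpa using hc)
  · intro a _
    rfl

theorem prod_Icc_one_sub_zpow_dseq (p q s j : ℕ) (hp : p.Prime) (hj : 1 ≤ j) (hjs : j ≤ s)
    (μ : ℂ) (hμ : IsPrimitiveRoot μ (p ^ j)) :
    ∏ t ∈ Finset.Icc 1 (q * (p ^ (s - 1) * (p - 1))), (1 - μ ^ dseq p t) =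
      (p : ℂ) ^ (q * p ^ (s - j)) := by
  have h0 : ¬ Nat.Coprime 0 p := by simpa using hp.one_lt.ne'
  by_cases hexc : p = 2 ∧ s = 1
  · obtain ⟨rfl, rfl⟩ := hexc
    obtain rfl : j = 1 := by omega
    have hμ1 : μ = -1 := by
      rw [pow_one] at hμ
      exact hμ.eq_neg_one_of_two_right
    rw [Finset.prod_congr rfl (g := fun _ => (2 : ℂ))]
    · simp
    · intro t _
      have hodd : Odd (dseq 2 t) := by
        have := dseq_isCoprime 2 t two_pos
        rw [← Int.not_even_iff_odd]
        intro he
        have := this.isUnit_of_dvd' he.two_dvd (by norm_num)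
        norm_num [Int.isUnit_iff] at this
      rw [hμ1, hodd.neg_one_zpow]; norm_num
  · set L := q * p ^ s with hL
    have hpL : p ∣ L := Dvd.dvd.mul_left (dvd_pow_self p (by omega)) q
    set b := (L + 1) / 2 with hb
    have hbL : 2 * b = L → ¬ Nat.Coprime b p := by
      intro h2 hc
      have hpb : p ∣ b := by
        rcases hp.eq_two_or_odd' with rfl | hodd
        · have h4 : 2 ^ 2 ∣ L := Dvd.dvd.mul_left (pow_dvd_pow 2 (by omega)) q
          omega
        · rw [← h2] at hpL
          exact (hp.dvd_mul.mp hpL).resolve_left fun h =>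
            absurd (Nat.prime_dvd_prime_iff_eq hp Nat.prime_two |>.mp h)
              (by rintro rfl; exact absurd hodd (by decide))
      exact hp.one_lt.ne' (Nat.dvd_one.mp (hc ▸ Nat.dvd_gcd hpb dvd_rfl))
    set c := Nat.count (fun k => 0 < k ∧ Nat.Coprime k p) b with hc
    have hcount : 2 * c = q * (p ^ (s - 1) * (p - 1)) := by
      have h := prod_coprime_mul_reflect p L b (fun _ => 2) hpL hb hbL
      simp only [Finset.prod_const] at h
      rw [← Nat.count_eq_card_filter_range, ← Nat.count_eq_card_filter_range,
        count_coprime_mul_pow p q s hp (by omega), ← hc, ← sq, ← pow_mul] at h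
      exact Nat.pow_right_injective le_rfl h
    have hμpj := hμ.pow_eq_one
    have hLj : L = q * p ^ (s - j) * p ^ j := by
      rw [hL, mul_assoc, ← pow_add, Nat.sub_add_cancel hjs]
    have hμL : μ ^ L = 1 := by rw [hLj, mul_comm, pow_mul, hμpj, one_pow]
    have hne : μ ≠ 0 := hμ.ne_zero (pow_pos hp.pos _).ne'
    rw [← hcount, prod_Icc_dseq p (fun d => 1 - μ ^ d) c, hc,
      prod_range_count_nth (fun k => 0 < k ∧ Nat.Coprime k p)
        (fun a => (1 - μ ^ (a : ℤ)) * (1 - μ ^ (-(a : ℤ)))) b]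
    have hr := prod_coprime_mul_reflect p L b (fun a => 1 - μ ^ a) hpL hb hbL
    have hq := prod_coprime_periodic p (p ^ j) (q * p ^ (s - j)) (fun a => 1 - μ ^ a)
      (dvd_pow_self p (by omega)) h0 (fun a => by rw [pow_add, hμpj, mul_one])
    rw [prod_coprime_one_sub_pow p j hp hj μ hμ, ← hLj] at hq
    rw [← hq, ← hr]
    refine Finset.prod_congr rfl fun a ha => ?_
    simp only [Finset.mem_filter, Finset.mem_range] at ha
    rw [zpow_natCast, zpow_neg, zpow_natCast]
    congr 2
    rw [inv_eq_one_div, ← hμL, div_eq_iff (pow_ne_zero _ hne), ← pow_add,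
      Nat.sub_add_cancel (by omega)]
/-- The product `e_m = ∏_{t=1}^m (1 - x^{d_t}) ∈ R_n`. -/
noncomputable def eulerProd (p n : ℕ) (hp : 0 < p) (m : ℕ) : Rring p n :=
  ∏ t ∈ Finset.Icc 1 m, (1 - xz p n hp (dseq p t))

theorem evalRoot_eulerProd (p n : ℕ) (hp : 0 < p) (m : ℕ) (μ : ℂ) (hμ : μ ^ p ^ n = 1) :
    evalRoot p n μ hμ (eulerProd p n hp m) = ∏ t ∈ Finset.Icc 1 m, (1 - μ ^ dseq p t) := by
  simp only [eulerProd, map_prod, map_sub, map_one, evalRoot_xz]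

theorem pow_eq_one_of_isPrimitiveRoot {p n j : ℕ} (hj : j ≤ n) {μ : ℂ}
    (hμ : IsPrimitiveRoot μ (p ^ j)) : μ ^ p ^ n = 1 :=
  (hμ.pow_eq_one_iff_dvd _).mpr (pow_dvd_pow p hj)

theorem one_sub_zpow_ne_zero (p j : ℕ) (hp : p.Prime) (hj : 1 ≤ j) (μ : ℂ)
    (hμ : IsPrimitiveRoot μ (p ^ j)) (d : ℤ) (hd : IsCoprime d (p : ℤ)) : 1 - μ ^ d ≠ 0 := by
  have h := prod_one_sub_zpow_primitiveRoots p j hp hj d hd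
  have hne : ∏ ν ∈ primitiveRoots (p ^ j) ℂ, (1 - ν ^ d) ≠ 0 := by
    rw [h]; exact_mod_cast hp.ne_zero
  exact Finset.prod_ne_zero_iff.mp hne μ ((mem_primitiveRoots (pow_pos hp.pos _)).mpr hμ)

theorem evalRoot_eulerProd_ne_zero (p n j : ℕ) (hp : p.Prime) (m : ℕ) (hj : 1 ≤ j) (μ : ℂ)
    (hμ : IsPrimitiveRoot μ (p ^ j)) (hμn : μ ^ p ^ n = 1) :
    evalRoot p n μ hμn (eulerProd p n hp.pos m) ≠ 0 := by
  rw [evalRoot_eulerProd, Finset.prod_ne_zero_iff]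
  intro t _
  exact one_sub_zpow_ne_zero p j hp hj μ hμ _ (dseq_isCoprime p t hp.pos)

theorem evalRoot_useq_mul_eulerProd (p n ℓ : ℕ) (hp : 0 < p) (m : ℕ) (μ : ℂ)
    (hμ : μ ^ p ^ n = 1) (hμ' : (μ ^ ℓ) ^ p ^ n = 1) :
    evalRoot p n μ hμ (useq p n hp ℓ m) * evalRoot p n μ hμ (eulerProd p n hp m) =
      evalRoot p n (μ ^ ℓ) hμ' (eulerProd p n hp m) := by
  rw [evalRoot_eulerProd, evalRoot_eulerProd]
  simp only [useq, map_prod, map_sum, evalRoot_xz]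
  rw [← Finset.prod_mul_distrib]
  refine Finset.prod_congr rfl fun t _ => ?_
  have h := geom_sum_mul_neg (μ ^ dseq p t) ℓ
  rw [← zpow_natCast μ ℓ, ← zpow_mul, mul_comm (ℓ : ℤ), zpow_mul, zpow_natCast, ← h]
  congr 1
  refine Finset.sum_congr rfl fun i _ => ?_
  rw [mul_comm, zpow_mul, zpow_natCast]

theorem le_mul_ceilDiv (m P : ℕ) (hP : 0 < P) : m ≤ P * ((m + P - 1) / P) := by
  have h1 := Nat.div_add_mod (m + P - 1) P
  have h2 := Nat.mod_lt (m + P - 1) hP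
  omega

theorem eulerProd_mul_Efun (p n : ℕ) (hp : p.Prime) (k s : ℕ) :
    eulerProd p n hp.pos (k * (p - 1)) * Efun p n hp.pos k s =
      eulerProd p n hp.pos (bfun p k s) := by
  have hP : 0 < p ^ (s - 1) * (p - 1) :=
    Nat.mul_pos (pow_pos hp.pos _) (Nat.sub_pos_of_lt hp.one_lt)
  have hle : k * (p - 1) ≤ bfun p k s := le_mul_ceilDiv _ _ hP
  have hIcc : ∀ a b : ℕ, Finset.Icc (a + 1) b = Finset.Ioc a b := fun a b => by
    ext; simp
  unfold eulerProd Efun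
  rw [show (1 : ℕ) = 0 + 1 from rfl, hIcc, hIcc, hIcc]
  exact Finset.prod_Ioc_consecutive _ (Nat.zero_le _) hle

theorem evalRoot_eulerProd_mul_Efun (p n : ℕ) (hp : p.Prime) (k s j : ℕ) (hj : 1 ≤ j)
    (hjs : j ≤ s) (μ : ℂ) (hμ : IsPrimitiveRoot μ (p ^ j)) (hμn : μ ^ p ^ n = 1) :
    evalRoot p n μ hμn (eulerProd p n hp.pos (k * (p - 1)) * Efun p n hp.pos k s) =
      (p : ℂ) ^ ((k * (p - 1) + p ^ (s - 1) * (p - 1) - 1) / (p ^ (s - 1) * (p - 1)) *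
        p ^ (s - j)) := by
  rw [eulerProd_mul_Efun p n hp, evalRoot_eulerProd, bfun, mul_comm (p ^ (s - 1) * (p - 1))]
  exact prod_Icc_one_sub_zpow_dseq p _ s j hp hj hjs μ hμ

theorem exists_eq_Tel_mul_of_evalRoot_eq_zero (p n s : ℕ) (hp : p.Prime) (hs : s ≤ n)
    (h : Rring p n) (H : ∀ j, s < j → j ≤ n → ∀ μ : ℂ, IsPrimitiveRoot μ (p ^ j) →
      ∀ hμn : μ ^ p ^ n = 1, evalRoot p n μ hμn h = 0) : ∃ g, h = Tel p n s * g := by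
  induction hs using Nat.decreasingInduction with
  | self => exact ⟨h, by simp [Tel]⟩
  | of_succ s hs ih =>
    obtain ⟨g, hg⟩ := ih fun j hj => H j (by omega)
    have hprim := Complex.isPrimitiveRoot_exp (p ^ (s + 1)) (pow_pos hp.pos _).ne'
    have hn := pow_eq_one_of_isPrimitiveRoot hs hprim
    have h0 := H (s + 1) (by omega) hs _ hprim hn
    rw [hg, map_mul, evalRoot_Tel_of_pow_eq_one _ _ _ _ _ hprim.pow_eq_one] at h0
    have hg0 := (mul_eq_zero.mp h0).resolve_left (pow_ne_zero _ (by exact_mod_cast hp.ne_zero))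
    obtain ⟨g', hg'⟩ := exists_eq_Tel_mul p n s hp hs _ hn hprim g hg0
    exact ⟨g', hg.trans hg'⟩

theorem evalRoot_Tel_eq_zero (p n s j : ℕ) (hp : p.Prime) (hs : s < j) (hj : j ≤ n) (μ : ℂ)
    (hμ : IsPrimitiveRoot μ (p ^ j)) (hμn : μ ^ p ^ n = 1) :
    evalRoot p n μ hμn (Tel p n s) = 0 := by
  refine evalRoot_Tel_of_pow_ne_one p n s (by omega) μ hμn ?_
  exact hμ.pow_ne_one_of_pos_of_lt (pow_pos hp.pos _).ne' (Nat.pow_lt_pow_right hp.one_lt hs)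

theorem mem_span_Tel_zero_iff (p n : ℕ) (hp : p.Prime) (h : Rring p n) :
    h ∈ Submodule.span ℤ {Tel p n 0} ↔ ∀ j, 0 < j → j ≤ n → ∀ μ : ℂ,
      IsPrimitiveRoot μ (p ^ j) → ∀ hμn : μ ^ p ^ n = 1, evalRoot p n μ hμn h = 0 := by
  constructor
  · intro hh j hj hjn μ hμ hμn
    obtain ⟨a, rfl⟩ := Submodule.mem_span_singleton.mp hh
    rw [map_zsmul, evalRoot_Tel_eq_zero p n 0 j hp hj hjn μ hμ hμn, smul_zero]
  · intro H
    obtain ⟨g, rfl⟩ := exists_eq_Tel_mul_of_evalRoot_eq_zero p n 0 hp (Nat.zero_le _) h H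
    exact Tel_zero_mul_mem p n g

/-- The elements `f` such that `f · e_m` takes, for each `1 ≤ j ≤ n`, the same value at all
primitive `p^j`-th roots of unity. -/
noncomputable def adamsFixed (p n : ℕ) (hp : 0 < p) (m : ℕ) : Submodule ℤ (Rring p n) where
  carrier := {f | ∀ j, 0 < j → j ≤ n → ∀ μ ν : ℂ, IsPrimitiveRoot μ (p ^ j) →
    IsPrimitiveRoot ν (p ^ j) → ∀ (hμ : μ ^ p ^ n = 1) (hν : ν ^ p ^ n = 1),
      evalRoot p n μ hμ (f * eulerProd p n hp m) = evalRoot p n ν hν (f * eulerProd p n hp m)}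
  zero_mem' := by
    intro j _ _ μ ν _ _ hμ hν
    simp
  add_mem' := by
    intro f g hf hg j hj hjn μ ν hμ' hν' hμ hν
    rw [add_mul, map_add, map_add, hf j hj hjn μ ν hμ' hν' hμ hν, hg j hj hjn μ ν hμ' hν' hμ hν]
  smul_mem' := by
    intro c f hf j hj hjn μ ν hμ' hν' hμ hν
    rw [smul_mul_assoc, map_zsmul, map_zsmul, hf j hj hjn μ ν hμ' hν' hμ hν]

theorem mem_adamsFixed_iff (p n m : ℕ) (hp : p.Prime) (f : Rring p n) :
    f ∈ adamsFixed p n hp.pos m ↔ ∀ ℓ : ℕ, 1 ≤ ℓ → Nat.Coprime ℓ p →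
      sigmaHom p n ℓ f * useq p n hp.pos ℓ m - f ∈ Submodule.span ℤ {Tel p n 0} := by
  have key : ∀ (ℓ : ℕ) (μ : ℂ) (hμ : μ ^ p ^ n = 1) (hμ' : (μ ^ ℓ) ^ p ^ n = 1),
      evalRoot p n μ hμ (sigmaHom p n ℓ f * useq p n hp.pos ℓ m - f) *
        evalRoot p n μ hμ (eulerProd p n hp.pos m) =
      evalRoot p n (μ ^ ℓ) hμ' (f * eulerProd p n hp.pos m) -
        evalRoot p n μ hμ (f * eulerProd p n hp.pos m) := by
    intro ℓ μ hμ hμ'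
    rw [map_sub, map_mul, sub_mul, mul_assoc, evalRoot_useq_mul_eulerProd p n ℓ hp.pos m μ hμ hμ',
      evalRoot_sigmaHom p n ℓ μ hμ hμ', map_mul, map_mul]
  constructor
  · intro hf ℓ _ hℓ
    rw [mem_span_Tel_zero_iff p n hp]
    intro j hj hjn μ hμ hμn
    have hμ' : (μ ^ ℓ) ^ p ^ n = 1 := by rw [← pow_mul, mul_comm, pow_mul, hμn, one_pow]
    have h := key ℓ μ hμn hμ'
    rw [hf j hj hjn (μ ^ ℓ) μ (hμ.pow_of_coprime ℓ (hℓ.pow_right j)) hμ hμ' hμn, sub_self] at h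
    exact (mul_eq_zero.mp h).resolve_right (evalRoot_eulerProd_ne_zero p n j hp m hj μ hμ hμn)
  · intro H j hj hjn μ ν hμ hν hμn hνn
    have : NeZero (p ^ j) := ⟨(pow_pos hp.pos _).ne'⟩
    obtain ⟨ℓ, -, hℓ, rfl⟩ := hμ.isPrimitiveRoot_iff.mp hν
    have hℓp : ℓ.Coprime p := (Nat.coprime_pow_right_iff hj ℓ p).mp hℓ
    have hℓ1 : 1 ≤ ℓ := Nat.pos_of_ne_zero (by
      rintro rfl
      exact hp.one_lt.ne' (by simpa using hℓp))
    have h := key ℓ μ hμn hνn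
    rw [(mem_span_Tel_zero_iff p n hp _).mp (H ℓ hℓ1 hℓp) j hj hjn μ hμ hμn, zero_mul] at h
    exact (sub_eq_zero.mp h.symm).symm

theorem Efun_mul_Tel_mem_adamsFixed (p n k s : ℕ) (hp : p.Prime) :
    Efun p n hp.pos k s * Tel p n s ∈ adamsFixed p n hp.pos (k * (p - 1)) := by
  intro j hj hjn μ ν hμ hν hμn hνn
  rw [mul_right_comm, map_mul, map_mul (evalRoot p n ν hνn)]
  rcases le_or_gt j s with hjs | hsj
  · rw [mul_comm (Efun _ _ _ _ _), evalRoot_eulerProd_mul_Efun p n hp k s j hj hjs μ hμ,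
      evalRoot_eulerProd_mul_Efun p n hp k s j hj hjs ν hν,
      evalRoot_Tel_of_pow_eq_one, evalRoot_Tel_of_pow_eq_one]
    · exact (hν.pow_eq_one_iff_dvd _).mpr (pow_dvd_pow p hjs)
    · exact (hμ.pow_eq_one_iff_dvd _).mpr (pow_dvd_pow p hjs)
  · rw [evalRoot_Tel_eq_zero p n s j hp hsj hjn μ hμ, evalRoot_Tel_eq_zero p n s j hp hsj hjn ν hν,
      mul_zero, mul_zero]

theorem pow_ceilDiv_dvd_of_pow_dvd_pow (p m P : ℕ) (hp : p.Prime) (hP : 0 < P) (c : ℤ)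
    (h : (p : ℤ) ^ m ∣ c ^ P) : (p : ℤ) ^ ((m + P - 1) / P) ∣ c := by
  have := Fact.mk hp
  rcases eq_or_ne c 0 with rfl | hc
  · simp
  have h' : p ^ m ∣ c.natAbs ^ P := by
    have := Int.natAbs_dvd_natAbs.mpr h
    rwa [Int.natAbs_pow, Int.natAbs_pow, Int.natAbs_natCast] at this
  have hc' : c.natAbs ≠ 0 := Int.natAbs_ne_zero.mpr hc
  rw [padicValNat_dvd_iff_le (pow_ne_zero _ hc'), padicValNat.pow] at h'
  rw [← Int.natCast_pow, Int.natCast_dvd, padicValNat_dvd_iff_le hc']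
  refine Nat.le_of_lt_succ ((Nat.div_lt_iff_lt_mul hP).mpr ?_)
  rw [Nat.succ_mul, mul_comm]
  omega

theorem exists_int_mul_pow_eq_evalRoot (p n m j : ℕ) (hp : p.Prime) (hj : 1 ≤ j) (hjn : j ≤ n)
    (g : Rring p n) (H : ∀ μ ν : ℂ, IsPrimitiveRoot μ (p ^ j) → IsPrimitiveRoot ν (p ^ j) →
      ∀ (hμ : μ ^ p ^ n = 1) (hν : ν ^ p ^ n = 1),
        evalRoot p n μ hμ (g * eulerProd p n hp.pos m) =
          evalRoot p n ν hν (g * eulerProd p n hp.pos m)) :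
    ∃ c : ℤ, ∀ μ : ℂ, IsPrimitiveRoot μ (p ^ j) → ∀ hμ : μ ^ p ^ n = 1,
      evalRoot p n μ hμ (g * eulerProd p n hp.pos m) =
        c * (p : ℂ) ^ ((m + p ^ (j - 1) * (p - 1) - 1) / (p ^ (j - 1) * (p - 1))) := by
  set P := p ^ (j - 1) * (p - 1) with hPdef
  have hP : 0 < P := Nat.mul_pos (pow_pos hp.pos _) (Nat.sub_pos_of_lt hp.one_lt)
  have hpos : 0 < p ^ j := pow_pos hp.pos _
  obtain ⟨G, rfl⟩ := Ideal.Quotient.mk_surjective g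
  obtain ⟨F, hF⟩ := Ideal.Quotient.mk_surjective (eulerProd p n hp.pos m)
  have hFe : ∀ μ : ℂ, IsPrimitiveRoot μ (p ^ j) →
      aeval μ F = ∏ t ∈ Finset.Icc 1 m, (1 - μ ^ dseq p t) := fun μ hμ => by
    rw [← evalRoot_mk p n μ (pow_eq_one_of_isPrimitiveRoot hjn hμ), hF, evalRoot_eulerProd]
  rw [← hF, ← map_mul] at H ⊢
  have hprim := Complex.isPrimitiveRoot_exp (p ^ j) hpos.ne'
  set ζ := Complex.exp (2 * Real.pi * Complex.I / (p ^ j : ℕ)) with hζ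
  have hconst : ∀ μ ∈ primitiveRoots (p ^ j) ℂ, aeval μ (G * F) = aeval ζ (G * F) :=
    fun μ hμ => H μ ζ ((mem_primitiveRoots hpos).mp hμ) hprim
      (pow_eq_one_of_isPrimitiveRoot hjn ((mem_primitiveRoots hpos).mp hμ))
      (pow_eq_one_of_isPrimitiveRoot hjn hprim)
  obtain ⟨z, hz⟩ := exists_int_of_const_on_primitiveRoots (p ^ j) hpos (G * F) _ hconst
  have hcard : (primitiveRoots (p ^ j) ℂ).card = P := by
    rw [Complex.card_primitiveRoots, Nat.totient_prime_pow hp (by omega)]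
  have hprod : ((z ^ P : ℤ) : ℂ) = ((p : ℤ) ^ m : ℤ) *
      ∏ μ ∈ primitiveRoots (p ^ j) ℂ, aeval μ G := by
    have h1 : ∏ μ ∈ primitiveRoots (p ^ j) ℂ, aeval μ F = (p : ℂ) ^ m := by
      rw [Finset.prod_congr rfl fun μ hμ => hFe μ ((mem_primitiveRoots hpos).mp hμ),
        Finset.prod_comm, Finset.prod_congr rfl fun t _ =>
          prod_one_sub_zpow_primitiveRoots p j hp hj _ (dseq_isCoprime p t hp.pos)]
      simp
    have h2 : ∏ μ ∈ primitiveRoots (p ^ j) ℂ, aeval μ (G * F) = (z : ℂ) ^ P := by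
      rw [Finset.prod_congr rfl hconst, Finset.prod_const, hcard, hz]
    push_cast
    rw [← h2, ← h1, ← Finset.prod_mul_distrib]
    exact Finset.prod_congr rfl fun μ _ => by rw [map_mul, mul_comm]
  have hint : IsIntegral ℤ (∏ μ ∈ primitiveRoots (p ^ j) ℂ, aeval μ G) := by
    refine IsIntegral.prod _ fun μ hμ => ?_
    exact adjoin_le_integralClosure (((mem_primitiveRoots hpos).mp hμ).isIntegral hpos)
      (aeval_mem_adjoin_singleton ℤ μ)
  obtain ⟨c, hc⟩ := pow_ceilDiv_dvd_of_pow_dvd_pow p m P hp hP z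
    (int_dvd_of_eq_mul_isIntegral _ _ _ hint hprod)
  refine ⟨c, fun μ hμ hμn => ?_⟩
  rw [evalRoot_mk, hconst μ ((mem_primitiveRoots hpos).mpr hμ), hz, hc]
  push_cast
  ring

theorem mkQ_mem_span_of_Tel_mul_mem_adamsFixed (p n k s : ℕ) (hp : p.Prime) (hs : s ≤ n)
    (g : Rring p n) (hg : Tel p n s * g ∈ adamsFixed p n hp.pos (k * (p - 1))) :
    (Submodule.span ℤ {Tel p n 0}).mkQ (Tel p n s * g) ∈
      Submodule.span ℤ ((fun s => (Submodule.span ℤ {Tel p n 0}).mkQ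
        (Efun p n hp.pos k s * Tel p n s)) '' Set.Icc 1 n) := by
  induction s generalizing g with
  | zero =>
    have : (Submodule.span ℤ {Tel p n 0}).mkQ (Tel p n 0 * g) = 0 :=
      (Submodule.Quotient.mk_eq_zero _).mpr (Tel_zero_mul_mem p n g)
    rw [this]
    exact zero_mem _
  | succ s ih =>
    have hT : ∀ μ : ℂ, IsPrimitiveRoot μ (p ^ (s + 1)) → ∀ hμ : μ ^ p ^ n = 1,
        evalRoot p n μ hμ (Tel p n (s + 1)) = (p : ℂ) ^ (n - (s + 1)) := fun μ hμ' hμ =>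
      evalRoot_Tel_of_pow_eq_one p n (s + 1) μ hμ hμ'.pow_eq_one
    have hp0 : (p : ℂ) ^ (n - (s + 1)) ≠ 0 := pow_ne_zero _ (by exact_mod_cast hp.ne_zero)
    obtain ⟨c, hc⟩ := exists_int_mul_pow_eq_evalRoot p n (k * (p - 1)) (s + 1) hp (by omega) hs g
      (by
        intro μ ν hμ' hν' hμ hν
        have h := hg (s + 1) (by omega) hs μ ν hμ' hν' hμ hν
        rw [mul_assoc, map_mul, map_mul (evalRoot p n ν hν), hT μ hμ', hT ν hν'] at h
        exact mul_left_cancel₀ hp0 h)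
    have hprim := Complex.isPrimitiveRoot_exp (p ^ (s + 1)) (pow_pos hp.pos _).ne'
    have hn := pow_eq_one_of_isPrimitiveRoot hs hprim
    have hzero : evalRoot p n _ hn (g - c • Efun p n hp.pos k (s + 1)) = 0 := by
      have hE := evalRoot_eulerProd_mul_Efun p n hp k (s + 1) (s + 1) (by omega) le_rfl _ hprim hn
      refine (mul_eq_zero.mp ?_).resolve_right (evalRoot_eulerProd_ne_zero p n (s + 1) hp
        (k * (p - 1)) (by omega) _ hprim hn)
      rw [← map_mul, sub_mul, map_sub, hc _ hprim hn, smul_mul_assoc, map_zsmul,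
        mul_comm (Efun _ _ _ _ _), hE, Nat.sub_self, pow_zero, mul_one, zsmul_eq_mul, sub_self]
    obtain ⟨g', hg'⟩ := exists_eq_Tel_mul p n s hp hs _ hn hprim _ hzero
    have hdecomp : Tel p n (s + 1) * g =
        Tel p n s * g' + c • (Efun p n hp.pos k (s + 1) * Tel p n (s + 1)) := by
      rw [← hg', mul_sub, mul_smul_comm, mul_comm (Efun _ _ _ _ _)]
      abel
    rw [hdecomp, map_add, map_smul]
    refine add_mem (ih (by omega) g' ?_) (Submodule.smul_mem _ _ (Submodule.subset_span
      ⟨s + 1, ⟨by omega, hs⟩, rfl⟩))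
    have : Tel p n s * g' =
        Tel p n (s + 1) * g - c • (Efun p n hp.pos k (s + 1) * Tel p n (s + 1)) := by
      rw [hdecomp]; abel
    rw [this]
    exact sub_mem hg (Submodule.smul_mem _ _ (Efun_mul_Tel_mem_adamsFixed p n k (s + 1) hp))

theorem linearIndependent_mkQ_Efun_mul_Tel (p n k : ℕ) (hp : p.Prime) :
    LinearIndependent ℤ fun s : (Finset.Icc 1 n : Finset ℕ) =>
      (Submodule.span ℤ {Tel p n 0}).mkQ (Efun p n hp.pos k (s : ℕ) * Tel p n (s : ℕ)) := by
  rw [Fintype.linearIndependent_iff]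
  intro a ha
  have hmem : ∑ s : (Finset.Icc 1 n : Finset ℕ),
      a s • (Efun p n hp.pos k (s : ℕ) * Tel p n (s : ℕ)) ∈ Submodule.span ℤ {Tel p n 0} := by
    rw [← Submodule.Quotient.mk_eq_zero, ← Submodule.mkQ_apply, map_sum]
    simpa only [map_smul] using ha
  rw [mem_span_Tel_zero_iff p n hp] at hmem
  have main : ∀ d j (hj : j ∈ Finset.Icc 1 n), n - j = d → a ⟨j, hj⟩ = 0 := by
    intro d
    induction d using Nat.strong_induction_on with
    | _ d ih =>
      intro j hj hd
      obtain ⟨hj1, hjn⟩ := Finset.mem_Icc.mp hj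
      have hprim := Complex.isPrimitiveRoot_exp (p ^ j) (pow_pos hp.pos _).ne'
      have hn := pow_eq_one_of_isPrimitiveRoot hjn hprim
      have h := hmem j hj1 hjn _ hprim hn
      rw [map_sum, Finset.sum_eq_single ⟨j, hj⟩] at h
      · rw [map_zsmul, map_mul, evalRoot_Tel_of_pow_eq_one _ _ _ _ _ hprim.pow_eq_one,
          zsmul_eq_mul] at h
        have hp0 : (p : ℂ) ≠ 0 := by exact_mod_cast hp.ne_zero
        have hE : evalRoot p n _ hn (Efun p n hp.pos k j) ≠ 0 := by
          intro h0
          have h1 := evalRoot_eulerProd_mul_Efun p n hp k j j hj1 le_rfl _ hprim hn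
          rw [map_mul, h0, mul_zero] at h1
          exact pow_ne_zero _ hp0 h1.symm
        exact_mod_cast (mul_eq_zero.mp h).resolve_right (mul_ne_zero hE (pow_ne_zero _ hp0))
      · rintro ⟨i, hi⟩ - hij
        have hij' : i ≠ j := fun h => hij (Subtype.ext h)
        obtain ⟨hi1, hin⟩ := Finset.mem_Icc.mp hi
        rcases lt_or_gt_of_ne hij' with hlt | hgt
        · rw [map_zsmul, map_mul, evalRoot_Tel_eq_zero p n i j hp hlt hjn _ hprim hn, mul_zero,
            smul_zero]
        · rw [ih (n - i) (by omega) i hi rfl, zero_smul, map_zero]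
      · simp
  exact fun s => main _ s.1 s.2 rfl

/-- With `m = k(p-1)`, `N = T_0` and `R̄_n = R_n/ℤ·N`, the additive group of elements of
`R̄_n` fixed by every induced Adams operation `ψ̄_m^{(ℓ)}` (`ℓ ≥ 1` coprime to `p`) is free
with ℤ-basis the classes of `E_s·T_s`, `1 ≤ s ≤ n`. (The induced map is expressed via
representatives: `f̄` is fixed iff `π(ψ_m^{(ℓ)}(f)) = π(f)` for every representative `f`.) -/
theorem stmt13 (p n k : ℕ) (hp : p.Prime) (hn : 1 ≤ n) (hk : 1 ≤ k) :
    let m := k * (p - 1)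
    let Nsub : Submodule ℤ (Rring p n) := Submodule.span ℤ {Tel p n 0}
    let π := Nsub.mkQ
    (LinearIndependent ℤ fun s : (Finset.Icc 1 n : Finset ℕ) =>
      π (Efun p n hp.pos k (s : ℕ) * Tel p n (s : ℕ))) ∧
    {y : Rring p n ⧸ Nsub | ∀ f : Rring p n, π f = y →
        ∀ ℓ : ℕ, 1 ≤ ℓ → Nat.Coprime ℓ p →
          π (sigmaHom p n ℓ f * useq p n hp.pos ℓ m) = π f}
      = ↑(Submodule.span ℤ ((fun s => π (Efun p n hp.pos k s * Tel p n s)) '' Set.Icc 1 n)) := by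
  intro m Nsub π
  refine ⟨linearIndependent_mkQ_Efun_mul_Tel p n k hp, ?_⟩
  have hN : Nsub ≤ adamsFixed p n hp.pos m := by
    intro f hf j hj hjn μ ν hμ hν hμn hνn
    rw [map_mul, map_mul, (mem_span_Tel_zero_iff p n hp f).mp hf j hj hjn μ hμ,
      (mem_span_Tel_zero_iff p n hp f).mp hf j hj hjn ν hν, zero_mul, zero_mul]
  have hfix : ∀ f : Rring p n, (∀ ℓ : ℕ, 1 ≤ ℓ → Nat.Coprime ℓ p →
      π (sigmaHom p n ℓ f * useq p n hp.pos ℓ m) = π f) ↔ f ∈ adamsFixed p n hp.pos m := by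
    intro f
    rw [mem_adamsFixed_iff p n m hp]
    simp only [π, Submodule.mkQ_apply, Submodule.Quotient.eq, Nsub]
  ext y
  simp only [Set.mem_ofPred_eq, SetLike.mem_coe, hfix]
  constructor
  · intro H
    obtain ⟨f, rfl⟩ := Nsub.mkQ_surjective y
    have hT : Tel p n n * f = f := by simp [Tel]
    have hf := H f rfl
    rw [← hT] at hf ⊢
    exact mkQ_mem_span_of_Tel_mul_mem_adamsFixed p n k n hp le_rfl f hf
  · rintro hy f rfl
    have hle : Submodule.span ℤ ((fun s => π (Efun p n hp.pos k s * Tel p n s)) '' Set.Icc 1 n) ≤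
        (adamsFixed p n hp.pos m).map π := by
      rw [Submodule.span_le]
      rintro _ ⟨s, -, rfl⟩
      exact ⟨_, Efun_mul_Tel_mem_adamsFixed p n k s hp, rfl⟩
    obtain ⟨f', hf', hff'⟩ := hle hy
    have hsub : f - f' ∈ Nsub := (Submodule.Quotient.eq Nsub).mp hff'.symm
    simpa using add_mem (hN hsub) hf'
end

section
/- Let p be a prime and n ≥ 1. Let N = T_0 ∈ R_n and let R̄_n = R_n/ℤ·N (note ℤ·N is the ideal generated by N, since x·N = N), and write T̄_s for the class of T_s in R̄_n. Then: (1) T̄_1, …, T̄_n are ℤ-linearly independent in R̄_n; and (2) the quotient of the ℤ-span of {T̄_1, …, T̄_n} by the ℤ-span of {p·T̄_1} ∪ {p·T̄_s − T̄_{s−1} : 2 ≤ s ≤ n} is cyclic of order p^n; explicitly, there is an additive isomorphism onto ℤ/p^nℤ sending the class of T̄_s to p^{n−s} mod p^n. (This is the identification of the quotient M_k^{C_{p^n}}/M_{k+1}^{C_{p^n}} ≅ ℤ/p^n in the critical degrees k = 2p^{n−1}(p−1)c − 1, via a^{1/2}t_{n,s}β_{(k+1)/2} ↦ p^{n−s}.)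 -/
open Polynomial

namespace Tel

theorem eq_mk (p n i : ℕ) :
    Tel p n i = Ideal.Quotient.mk _ (∑ t ∈ Finset.range (p ^ (n - i)), (X : ℤ[X]) ^ (t * p ^ i)) := by
  simp [Tel, xcl]

theorem coeff_sum_X_pow {p n i j : ℕ} (hp : 0 < p) (hi : i ≤ n) (hj : j < p ^ n) :
    (∑ t ∈ Finset.range (p ^ (n - i)), (X : ℤ[X]) ^ (t * p ^ i)).coeff j =
      if p ^ i ∣ j then 1 else 0 := by
  have hpi : 0 < p ^ i := pow_pos hp i
  simp only [finsetSum_coeff, coeff_X_pow]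
  split_ifs with h
  · obtain ⟨k, rfl⟩ := h
    have hk : k < p ^ (n - i) := by
      rw [← Nat.add_sub_cancel' hi, pow_add] at hj
      simpa using Nat.lt_of_mul_lt_mul_left hj
    rw [Finset.sum_eq_single_of_mem k (Finset.mem_range.2 hk)]
    · simp [mul_comm]
    · intro t _ ht
      rw [if_neg]
      rw [mul_comm]
      exact fun h => ht (Nat.eq_of_mul_eq_mul_right hpi h).symm
  · refine Finset.sum_eq_zero fun t _ => if_neg ?_
    rintro rfl
    exact h (dvd_mul_left _ _)

theorem degree_sum_X_pow_lt {p n i : ℕ} (hp : 0 < p) (hi : i ≤ n) :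
    (∑ t ∈ Finset.range (p ^ (n - i)), (X : ℤ[X]) ^ (t * p ^ i)).degree < (p ^ n : ℕ) := by
  refine lt_of_le_of_lt (degree_sum_le _ _) ?_
  refine (Finset.sup_lt_iff (WithBot.bot_lt_coe _)).2 fun t ht => ?_
  rw [degree_X_pow, Nat.cast_lt, ← Nat.sub_add_cancel hi, pow_add]
  exact Nat.mul_lt_mul_of_pos_right (Finset.mem_range.1 ht) (pow_pos hp i)

theorem linearIndepOn {p : ℕ} (hp : p.Prime) (n : ℕ) :
    LinearIndepOn ℤ (Tel p n) (Finset.range (n + 1)) := by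
  rw [linearIndepOn_finset_iff]
  intro f hf
  set P : ℤ[X] := ∑ i ∈ Finset.range (n + 1),
    f i • ∑ t ∈ Finset.range (p ^ (n - i)), (X : ℤ[X]) ^ (t * p ^ i) with hP
  have hpn : p ^ n ≠ 0 := (pow_pos hp.pos n).ne'
  have hdvd : (X : ℤ[X]) ^ p ^ n - 1 ∣ P := by
    rw [← Ideal.mem_span_singleton, ← Ideal.Quotient.eq_zero_iff_mem, ← hf, hP, map_sum]
    exact Finset.sum_congr rfl fun i _ => by rw [map_zsmul, eq_mk]
  have hdeg : P.degree < ((X : ℤ[X]) ^ p ^ n - 1).degree := by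
    have h1 : ((X : ℤ[X]) ^ p ^ n - 1).degree = (p ^ n : ℕ) := by
      simpa using degree_X_pow_sub_C (Nat.pos_of_ne_zero hpn) (1 : ℤ)
    rw [h1]
    refine lt_of_le_of_lt (degree_sum_le _ _) ?_
    refine (Finset.sup_lt_iff (WithBot.bot_lt_coe _)).2 fun i hi => ?_
    exact (degree_smul_le _ _).trans_lt
      (degree_sum_X_pow_lt hp.pos (Nat.lt_succ_iff.1 (Finset.mem_range.1 hi)))
  have hmonic : ((X : ℤ[X]) ^ p ^ n - 1).Monic := by
    simpa using monic_X_pow_sub_C (1 : ℤ) hpn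
  have hP0 : P = 0 := by
    by_contra h
    exact hmonic.not_dvd_of_degree_lt h hdeg hdvd
  have hcoeff : ∀ j < p ^ n,
      ∑ i ∈ Finset.range (n + 1), (if p ^ i ∣ j then f i else 0) = 0 := by
    intro j hj
    have := congrArg (fun Q => coeff Q j) hP0
    simp only [hP, finsetSum_coeff, coeff_smul, coeff_zero] at this
    refine (Finset.sum_congr rfl fun i hi => ?_).trans this
    rw [← finsetSum_coeff,
      coeff_sum_X_pow hp.pos (Nat.lt_succ_iff.1 (Finset.mem_range.1 hi)) hj]
    simp
  intro i
  induction i using Nat.strong_induction_on with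
  | _ i ih =>
    intro hi
    have hin : i ≤ n := Nat.lt_succ_iff.1 (Finset.mem_range.1 hi)
    obtain ⟨j, hj, hji, hjk⟩ : ∃ j < p ^ n, p ^ i ∣ j ∧ ∀ k ≤ n, i < k → ¬ p ^ k ∣ j := by
      rcases hin.lt_or_eq with h | rfl
      · refine ⟨p ^ i, Nat.pow_lt_pow_right hp.one_lt h, dvd_rfl, fun k _ hk hd => ?_⟩
        exact hk.not_ge ((Nat.pow_dvd_pow_iff_le_right hp.one_lt).1 hd)
      · exact ⟨0, pow_pos hp.pos _, dvd_zero _, fun k hk hk' => absurd hk hk'.not_ge⟩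
    have h := hcoeff j hj
    rw [Finset.sum_eq_single_of_mem i hi, if_pos hji] at h
    · exact h
    · intro k hk hki
      rcases hki.lt_or_gt with h | h
      · rw [ih k h hk, ite_self]
      · exact if_neg (hjk k (Nat.lt_succ_iff.1 (Finset.mem_range.1 hk)) h)

theorem linearIndepOn_mkQ {p : ℕ} (hp : p.Prime) (n : ℕ) :
    LinearIndepOn ℤ (fun s => (Submodule.span ℤ {Tel p n 0}).mkQ (Tel p n s))
      (Finset.Icc 1 n) := by
  rw [linearIndepOn_finset_iff]
  intro f hf i hi
  simp only [← map_smul, ← map_sum] at hf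
  rw [Submodule.mkQ_apply, Submodule.Quotient.mk_eq_zero, Submodule.mem_span_singleton] at hf
  obtain ⟨c, hc⟩ := hf
  have hlin := linearIndepOn_finset_iff.1 (linearIndepOn hp n)
    (fun i => if i = 0 then -c else f i) ?_ i ?_
  · simpa [(Nat.one_le_iff_ne_zero.1 (Finset.mem_Icc.1 hi).1)] using hlin
  · rw [Finset.range_eq_Ico, Finset.sum_eq_sum_Ico_succ_bot (Nat.succ_pos n), if_pos rfl, neg_smul,
      hc, neg_add_eq_zero]
    refine Finset.sum_congr rfl fun i hi => ?_
    rw [if_neg (Nat.one_le_iff_ne_zero.1 (Finset.mem_Icc.1 hi).1)]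
  · exact Finset.mem_range.2 (Nat.lt_succ_iff.2 (Finset.mem_Icc.1 hi).2)

end Tel

/-- The augmentation `x ↦ 1` of `R_n`, reduced modulo `p ^ n`. -/
noncomputable def augmentation (p n : ℕ) : Rring p n →+* ZMod (p ^ n) :=
  Ideal.Quotient.lift _ (eval₂RingHom (Int.castRingHom (ZMod (p ^ n))) 1) fun a ha => by
    obtain ⟨b, rfl⟩ := Ideal.mem_span_singleton.1 ha
    simp

theorem augmentation_Tel (p n i : ℕ) :
    augmentation p n (Tel p n i) = (p : ZMod (p ^ n)) ^ (n - i) := by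
  simp [augmentation, Tel, xcl]

theorem augmentation_Tel_zero (p n : ℕ) : augmentation p n (Tel p n 0) = 0 := by
  rw [augmentation_Tel, Nat.sub_zero, ← Nat.cast_pow, ZMod.natCast_self]

/-- If `p • v s - v (s - 1)` lies in `B` for `2 ≤ s ≤ n`, then `v s` is congruent to
`p ^ (n - s) • v n` modulo `B`. -/
theorem sub_pow_smul_mem {M : Type*} [AddCommGroup M] {B : Submodule ℤ M} {v : ℕ → M} {p : ℤ}
    {n : ℕ} (h : ∀ s, 2 ≤ s → s ≤ n → p • v s - v (s - 1) ∈ B) {s : ℕ} (hs : 1 ≤ s) (hsn : s ≤ n) :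
    v s - p ^ (n - s) • v n ∈ B := by
  induction hsn using Nat.decreasingInduction with
  | self => simp
  | of_succ k hk ih =>
    have h1 := B.smul_mem p (ih (by omega))
    have h2 := h (k + 1) (by omega) hk
    have h3 : n - k = n - (k + 1) + 1 := by omega
    rw [Nat.add_sub_cancel] at h2
    convert B.sub_mem h1 h2 using 1
    rw [h3, pow_succ', mul_smul, smul_sub]
    abel

/-- With `N = T_0` and `R̄_n = R_n/ℤ·N`: (1) the classes `T̄_1, …, T̄_n` are ℤ-linearly
independent; (2) the quotient of the ℤ-span of `{T̄_1, …, T̄_n}` by the ℤ-span of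
`{p·T̄_1} ∪ {p·T̄_s − T̄_{s−1} : 2 ≤ s ≤ n}` is cyclic of order `p^n`, explicitly via a
surjective additive map onto `ℤ/p^nℤ` sending `T̄_s` to `p^{n−s}` whose kernel is the
latter span. -/
theorem stmt16 (p n : ℕ) (hp : p.Prime) (hn : 1 ≤ n) :
    let Nsub : Submodule ℤ (Rring p n) := Submodule.span ℤ {Tel p n 0}
    let π := Nsub.mkQ
    let A : Submodule ℤ (Rring p n ⧸ Nsub) :=
      Submodule.span ℤ ((fun s => π (Tel p n s)) '' Set.Icc 1 n)
    let B : Submodule ℤ (Rring p n ⧸ Nsub) :=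
      Submodule.span ℤ ({(p : ℤ) • π (Tel p n 1)} ∪
        {y | ∃ s, 2 ≤ s ∧ s ≤ n ∧ y = (p : ℤ) • π (Tel p n s) - π (Tel p n (s - 1))})
    (LinearIndependent ℤ fun s : (Finset.Icc 1 n : Finset ℕ) => π (Tel p n (s : ℕ))) ∧
    B ≤ A ∧
    ∃ φ : A →ₗ[ℤ] ZMod (p ^ n), Function.Surjective φ ∧
      (∀ s : ℕ, ∀ hs : s ∈ Set.Icc 1 n,
        φ ⟨π (Tel p n s), Submodule.subset_span (Set.mem_image_of_mem _ hs)⟩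
          = (p : ZMod (p ^ n)) ^ (n - s)) ∧
      ∀ a : A, φ a = 0 ↔ (a : Rring p n ⧸ Nsub) ∈ B := by
  intro Nsub π A B
  have hmem : ∀ s ∈ Set.Icc 1 n, π (Tel p n s) ∈ A := fun s hs =>
    Submodule.subset_span (Set.mem_image_of_mem _ hs)
  have hB1 : (p : ℤ) • π (Tel p n 1) ∈ B := Submodule.subset_span (Or.inl rfl)
  have hB2 : ∀ s, 2 ≤ s → s ≤ n → (p : ℤ) • π (Tel p n s) - π (Tel p n (s - 1)) ∈ B :=
    fun s h2 hs => Submodule.subset_span (Or.inr ⟨s, h2, hs, rfl⟩)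
  let ψ : (Rring p n ⧸ Nsub) →ₗ[ℤ] ZMod (p ^ n) :=
    Nsub.liftQ (augmentation p n).toAddMonoidHom.toIntLinearMap <| by
      rw [Submodule.span_le, Set.singleton_subset_iff]
      exact augmentation_Tel_zero p n
  have hψ : ∀ s, ψ (π (Tel p n s)) = (p : ZMod (p ^ n)) ^ (n - s) := augmentation_Tel p n
  have hψn : ψ (π (Tel p n n)) = 1 := by rw [hψ, Nat.sub_self, pow_zero]
  have hBψ : B ≤ LinearMap.ker ψ := by
    rw [Submodule.span_le]
    rintro y (rfl | ⟨s, h2, hs, rfl⟩)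
    · rw [SetLike.mem_coe, LinearMap.mem_ker, map_smul, hψ, zsmul_eq_mul, Int.cast_natCast,
        ← pow_succ', Nat.sub_add_cancel hn, ← Nat.cast_pow, ZMod.natCast_self]
    · have h : n - (s - 1) = n - s + 1 := by omega
      rw [SetLike.mem_coe, LinearMap.mem_ker, map_sub, map_smul, hψ, hψ, zsmul_eq_mul,
        Int.cast_natCast, ← pow_succ', h, sub_self]
  have hpow : ((p : ℤ) ^ n) • π (Tel p n n) ∈ B := by
    have h1 := B.sub_mem hB1 (B.smul_mem (p : ℤ) (sub_pow_smul_mem hB2 le_rfl hn))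
    rwa [smul_sub, sub_sub_cancel, smul_smul, ← pow_succ', Nat.sub_add_cancel hn] at h1
  have hA : ∀ a ∈ A, ∃ m : ℤ, a - m • π (Tel p n n) ∈ B := by
    intro a ha
    induction ha using Submodule.span_induction with
    | mem x hx =>
      obtain ⟨s, hs, rfl⟩ := hx
      exact ⟨_, sub_pow_smul_mem hB2 hs.1 hs.2⟩
    | zero => exact ⟨0, by simp⟩
    | add x y _ _ hx hy =>
      obtain ⟨k, hk⟩ := hx
      obtain ⟨l, hl⟩ := hy
      exact ⟨k + l, by rw [add_smul, add_sub_add_comm]; exact B.add_mem hk hl⟩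
    | smul c x _ hx =>
      obtain ⟨k, hk⟩ := hx
      exact ⟨c * k, by rw [mul_smul, ← smul_sub]; exact B.smul_mem c hk⟩
  refine ⟨Tel.linearIndepOn_mkQ hp n, ?_, ψ.domRestrict A, ?_, fun s _ => hψ s, ?_⟩
  · rw [Submodule.span_le]
    rintro y (rfl | ⟨s, h2, hs, rfl⟩)
    · exact A.smul_mem _ (hmem 1 ⟨le_rfl, hn⟩)
    · exact A.sub_mem (A.smul_mem _ (hmem s ⟨by omega, hs⟩)) (hmem (s - 1) ⟨by omega, by omega⟩)
  · intro z
    obtain ⟨m, rfl⟩ := ZMod.intCast_surjective z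
    refine ⟨m • ⟨_, hmem n ⟨hn, le_rfl⟩⟩, ?_⟩
    rw [map_smul, LinearMap.domRestrict_apply, hψn, zsmul_one]
  · rintro ⟨a, ha⟩
    refine ⟨fun h => ?_, fun h => hBψ h⟩
    obtain ⟨m, hm⟩ := hA a ha
    have h0 : (m : ZMod (p ^ n)) = 0 := by
      have h1 : ψ a = 0 := h
      have h2 : ψ (a - m • π (Tel p n n)) = 0 := hBψ hm
      rwa [map_sub, h1, map_smul, hψn, zsmul_one, zero_sub, neg_eq_zero] at h2
    obtain ⟨k, rfl⟩ := (ZMod.intCast_zmod_eq_zero_iff_dvd m (p ^ n)).1 h0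
    have h3 := B.smul_mem k hpow
    rw [smul_smul] at h3
    convert B.add_mem hm h3 using 1
    rw [Nat.cast_pow, mul_comm k, sub_add_cancel]
end
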